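/- arXiv:1903.05304 — 11 statements merged into one kernel-verified Lean document; each statement's English description precedes it below -/
import Mathlib

section
/- Let P ⊆ ℝⁿ be a convex set and let S ⊆ P be a nonempty, closed, convex subset. Then depth_P(S) ≤ d(S, P), where d(S, P) := sup_{x ∈ P} inf_{y ∈ S} ‖x − y‖₂. -/
open Metric Set
open scoped ENNReal InnerProductSpace

/-- The depth of a point `x` with respect to `P`:
`sup { r ≥ 0 : B(x,r) ∩ aff(P) ⊆ P }` (valued in `ℝ≥0∞`). -/
noncomputable def ptDepth {ι : Type*} [Fintype ι]
    (P : Set (EuclideanSpace ℝ ι)) (x : EuclideanSpace ℝ ι) : ℝ≥0∞ :=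
  ⨆ r ∈ {r : ℝ | 0 ≤ r ∧
      Metric.closedBall x r ∩ (affineSpan ℝ P : Set (EuclideanSpace ℝ ι)) ⊆ P},
    ENNReal.ofReal r

/-- The depth of a subset `S ⊆ P` with respect to `P`:
`sup { depth_P(x) : x ∈ P \ S }` (sup of the empty set is `0`). -/
noncomputable def setDepth {ι : Type*} [Fintype ι]
    (P S : Set (EuclideanSpace ℝ ι)) : ℝ≥0∞ :=
  ⨆ x ∈ P \ S, ptDepth P x


/-- Moving a point `x` outside a closed convex set `S` by `r` in the direction away from its
nearest point in `S` yields a point at distance at least `r` from `S`. -/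
theorem exists_add_smul_sub_le_infEDist {E : Type*} [NormedAddCommGroup E] [InnerProductSpace ℝ E]
    {S : Set E} (hne : S.Nonempty) (hS : IsComplete S) (hconv : Convex ℝ S) {x : E}
    (hx : x ∉ S) {r : ℝ} (hr : 0 ≤ r) :
    ∃ s ∈ S, ∃ t : ℝ, ‖t • (x - s)‖ = r ∧
      ENNReal.ofReal r ≤ Metric.infEDist (x + t • (x - s)) S := by
  obtain ⟨s, hs, hmin⟩ := exists_norm_eq_iInf_of_complete_convex hne hS hconv x
  have hinner := (norm_eq_iInf_iff_real_inner_le_zero hconv hs).1 hmin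
  have hpos : 0 < ‖x - s‖ := norm_pos_iff.2 (sub_ne_zero.2 fun h => hx (h ▸ hs))
  refine ⟨s, hs, r / ‖x - s‖, ?_, Metric.le_infEDist.2 fun y hy => ?_⟩
  · rw [norm_smul, Real.norm_of_nonneg (by positivity), div_mul_cancel₀ _ hpos.ne']
  · rw [edist_dist, dist_eq_norm]
    refine ENNReal.ofReal_le_ofReal (le_of_mul_le_mul_left ?_ hpos)
    calc ‖x - s‖ * r ≤ ⟪x - s, x + (r / ‖x - s‖) • (x - s) - y⟫_ℝ := by
          have hdecomp : x + (r / ‖x - s‖) • (x - s) - y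
              = (x - s) + (r / ‖x - s‖) • (x - s) - (y - s) := by abel
          have hmul : r / ‖x - s‖ * ‖x - s‖ ^ 2 = ‖x - s‖ * r := by field_simp
          rw [hdecomp, inner_sub_right, inner_add_right, inner_smul_right,
            real_inner_self_eq_norm_sq, hmul]
          linarith [hinner y hy, sq_nonneg ‖x - s‖]
      _ ≤ ‖x - s‖ * ‖x + (r / ‖x - s‖) • (x - s) - y‖ := real_inner_le_norm _ _

/-- For a convex set `P ⊆ ℝⁿ` and a nonempty closed convex subset `S ⊆ P`,
`depth_P(S) ≤ d(S, P) := sup_{x ∈ P} inf_{y ∈ S} ‖x − y‖₂`. -/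
theorem depth_le_dist {n : ℕ} (P S : Set (EuclideanSpace ℝ (Fin n)))
    (hP : Convex ℝ P) (hSP : S ⊆ P) (hSne : S.Nonempty)
    (hScl : IsClosed S) (hSconv : Convex ℝ S) :
    setDepth P S ≤ ⨆ x ∈ P, EMetric.infEdist x S := by
  refine iSup₂_le fun x hx => iSup₂_le fun r hr => ?_
  obtain ⟨s, hs, t, hnorm, hle⟩ :=
    exists_add_smul_sub_le_infEDist hSne hScl.isComplete hSconv hx.2 hr.1
  have hmem : x + t • (x - s) ∈ P := by
    refine hr.2 ⟨?_, ?_⟩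
    · simp [Metric.mem_closedBall, dist_eq_norm, hnorm]
    · have hxP := subset_affineSpan ℝ P hx.1
      have := AffineSubspace.smul_vsub_vadd_mem _ t hxP (subset_affineSpan ℝ P (hSP hs)) hxP
      rwa [vsub_eq_sub, vadd_eq_add, add_comm] at this
  exact le_iSup₂_of_le (f := fun x (_ : x ∈ P) => Metric.infEDist x S) _ hmem hle
end

section
/- Let n ≥ 2. For every point y ∈ ℝⁿ there exists a finite set F ⊆ ℤⁿ of integer points such that y ∈ conv(F) and every point z ∈ conv(F) satisfies ‖z − y‖₂ < √((n+1)/2); that is, there is a lattice polytope containing y and contained in the open Euclidean ball of radius √((n+1)/2) centered at y. -/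
open Metric Set

/-- From a point `w` of the unit cube, one can move in a nonzero direction `d` that is supported on
the fractional coordinates of `w` until a further coordinate becomes integral. -/
theorem exists_pos_add_smul_mem_cube {ι : Type*} [Fintype ι] {w d : ι → ℝ}
    (hw : ∀ i, w i ∈ Icc (0 : ℝ) 1) (hd : d ≠ 0) (hdw : ∀ i, d i ≠ 0 → w i ∈ Ioo (0 : ℝ) 1) :
    ∃ t : ℝ, 0 < t ∧ (∀ i, (w + t • d) i ∈ Icc (0 : ℝ) 1) ∧
      {i | (w + t • d) i ∈ Ioo (0 : ℝ) 1} ⊂ {i | w i ∈ Ioo (0 : ℝ) 1} := by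
  classical
  have hit : ∀ i, d i ≠ 0 → ∃ t : ℝ, 0 < t ∧
      (∀ s, 0 < s → s ≤ t → w i + s * d i ∈ Icc (0 : ℝ) 1) ∧ w i + t * d i ∉ Ioo (0 : ℝ) 1 := by
    intro i hi
    obtain ⟨h0, h1⟩ := hdw i hi
    rcases lt_or_gt_of_ne hi with h | h
    · have e : w i / (-d i) * d i = -w i := by field_simp
      refine ⟨w i / (-d i), div_pos h0 (by linarith), fun s hs hst => ?_, fun hm => ?_⟩
      · constructor <;> nlinarith
      · linarith [hm.1]
    · have e : (1 - w i) / d i * d i = 1 - w i := by field_simp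
      refine ⟨(1 - w i) / d i, div_pos (by linarith) h, fun s hs hst => ?_, fun hm => ?_⟩
      · constructor <;> nlinarith
      · linarith [hm.2]
  choose! T hT0 hT1 hT2 using hit
  obtain ⟨j, hj⟩ := Function.ne_iff.mp hd
  obtain ⟨k, hk, hmin⟩ := Finset.exists_min_image (Finset.univ.filter fun i => d i ≠ 0) T
    ⟨j, by simpa using hj⟩
  simp only [Finset.mem_filter, Finset.mem_univ, true_and] at hk hmin
  refine ⟨T k, hT0 k hk, fun i => ?_, ?_⟩
  · by_cases hi : d i = 0
    · simpa [hi] using hw i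
    · simpa using hT1 i hi (T k) (hT0 k hk) (hmin i hi)
  · refine ssubset_iff_exists.mpr ⟨fun i hi => ?_, k, hdw k hk, ?_⟩
    · by_cases h : d i = 0
      · simpa [h] using hi
      · exact hdw i h
    · simpa using hT2 k hk

open Matrix in
/-- A point `w` of the unit cube lies in every convex set containing the vertices `v` of the cube
with `a ⬝ᵥ v < a ⬝ᵥ w + 1`, if the entries of `a` have absolute value at most one. -/
theorem Convex.mem_of_cube_vertices_mem {ι : Type*} [Fintype ι] {a : ι → ℝ} (ha : ∀ i, |a i| ≤ 1)
    {c : ℝ} {C : Set (ι → ℝ)} (hC : Convex ℝ C)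
    (hv : ∀ v : ι → ℝ, (∀ i, v i = 0 ∨ v i = 1) → a ⬝ᵥ v < c + 1 → v ∈ C)
    (w : ι → ℝ) (hw : ∀ i, w i ∈ Icc (0 : ℝ) 1) (hc : a ⬝ᵥ w = c) : w ∈ C := by
  classical
  induction hN : {i | w i ∈ Ioo (0 : ℝ) 1}.ncard using Nat.strong_induction_on generalizing w with
  | _ N ih =>
  have vertex : ∀ i, w i ∉ Ioo (0 : ℝ) 1 → w i = 0 ∨ w i = 1 := by
    intro i hi
    by_contra! h
    exact hi ⟨lt_of_le_of_ne (hw i).1 h.1.symm, lt_of_le_of_ne (hw i).2 h.2⟩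
  by_cases hfrac : ∃ i, w i ∈ Ioo (0 : ℝ) 1
  swap
  · push Not at hfrac
    exact hv w (fun i => vertex i (hfrac i)) (by linarith)
  obtain ⟨i, hi⟩ := hfrac
  by_cases htwo : ∃ j, j ≠ i ∧ w j ∈ Ioo (0 : ℝ) 1
  · obtain ⟨j, hji, hj⟩ := htwo
    obtain ⟨p, q, hpq, hapq⟩ : ∃ p q : ℝ, (p ≠ 0 ∨ q ≠ 0) ∧ a i * p + a j * q = 0 := by
      by_cases h : a i = 0
      · exact ⟨1, 0, by simp, by simp [h]⟩
      · exact ⟨a j, -a i, by simp [h], by ring⟩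
    set d : ι → ℝ := Pi.single i p + Pi.single j q with hd_def
    have hdi : d i = p := by simp [hd_def, hji.symm]
    have hdj : d j = q := by simp [hd_def, hji]
    have had : a ⬝ᵥ d = 0 := by simp [hd_def, dotProduct_add, hapq]
    have hd : d ≠ 0 := by
      rintro h
      rw [h] at hdi hdj
      rcases hpq with h | h
      · exact h hdi.symm
      · exact h hdj.symm
    have hdw : ∀ k, d k ≠ 0 → w k ∈ Ioo (0 : ℝ) 1 := by
      intro k hk
      by_cases hki : k = i
      · exact hki ▸ hi
      by_cases hkj : k = j
      · exact hkj ▸ hj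
      · simp [hd_def, hki, hkj] at hk
    obtain ⟨t, ht, htw, hts⟩ := exists_pos_add_smul_mem_cube hw hd hdw
    obtain ⟨s, hs, hsw, hss⟩ := exists_pos_add_smul_mem_cube (d := -d) hw (neg_ne_zero.mpr hd)
      (fun k hk => hdw k (by simpa using hk))
    have h₁ : w + t • d ∈ C := ih _ (hN ▸ ncard_lt_ncard hts) _ htw
      (by simp [dotProduct_add, had, hc]) rfl
    have h₂ : w + s • -d ∈ C := ih _ (hN ▸ ncard_lt_ncard hss) _ hsw
      (by simp [dotProduct_add, had, hc]) rfl
    have hst : 0 < s + t := by positivity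
    convert hC h₁ h₂ (a := s / (s + t)) (b := t / (s + t)) (by positivity) (by positivity)
      (by field_simp) using 1
    ext k
    simp only [Pi.add_apply, Pi.smul_apply, Pi.neg_apply, smul_eq_mul]
    field_simp
    ring
  · push Not at htwo
    have hmem : ∀ b : ℝ, (b = 0 ∨ b = 1) → w + Pi.single i (b - w i) ∈ C := by
      intro b hb
      refine hv _ (fun k => ?_) ?_
      · by_cases hk : k = i
        · subst hk
          simpa using hb
        · simpa [hk] using vertex k (htwo k hk)
      · rw [dotProduct_add, dotProduct_single, hc]
        have := abs_le.mp (ha i)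
        rcases hb with rfl | rfl <;> nlinarith [hi.1, hi.2]
    convert hC (hmem 0 (Or.inl rfl)) (hmem 1 (Or.inr rfl)) (a := 1 - w i) (b := w i)
      (by linarith [hi.2]) hi.1.le (by ring) using 1
    ext k
    by_cases hk : k = i
    · subst hk
      simp
      ring
    · simp [hk]
      ring

/-- For `n ≥ 2` and any `y ∈ ℝⁿ`, there is a finite set `F ⊆ ℤⁿ` of integer
points such that `y ∈ conv(F)` and every `z ∈ conv(F)` satisfies `‖z − y‖₂ < √((n+1)/2)`;
i.e. a lattice polytope containing `y` and contained in the open ball of radius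
`√((n+1)/2)` centered at `y`. -/
theorem exists_lattice_polytope {n : ℕ} (hn : 2 ≤ n) (y : EuclideanSpace ℝ (Fin n)) :
    ∃ F : Finset (EuclideanSpace ℝ (Fin n)),
      (∀ v ∈ F, ∀ i, ∃ m : ℤ, v i = m) ∧
      y ∈ convexHull ℝ (F : Set (EuclideanSpace ℝ (Fin n))) ∧
      ∀ z ∈ convexHull ℝ (F : Set (EuclideanSpace ℝ (Fin n))),
        ‖z - y‖ < Real.sqrt ((n + 1) / 2) := by
  classical
  set F : Finset (EuclideanSpace ℝ (Fin n)) :=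
    ((Fintype.piFinset fun i => ({⌊y i⌋, ⌊y i⌋ + 1} : Finset ℤ)).image
      fun m => WithLp.toLp 2 fun i => (m i : ℝ)).filter
      fun v => ‖v - y‖ < Real.sqrt ((n + 1) / 2) with hF
  refine ⟨F, fun v hv i => ?_, ?_, fun z hz => ?_⟩
  · simp only [hF, Finset.mem_filter, Finset.mem_image] at hv
    obtain ⟨⟨m, -, rfl⟩, -⟩ := hv
    exact ⟨m i, rfl⟩
  · set p : EuclideanSpace ℝ (Fin n) := WithLp.toLp 2 fun i => (⌊y i⌋ : ℝ) with hp
    set f : Fin n → ℝ := fun i => Int.fract (y i) with hf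
    have hC : Convex ℝ {x : Fin n → ℝ | p + WithLp.toLp 2 x ∈
        convexHull ℝ (F : Set (EuclideanSpace ℝ (Fin n)))} :=
      ((convex_convexHull ℝ (F : Set (EuclideanSpace ℝ (Fin n)))).translate_preimage_right
        p).linear_preimage (WithLp.linearEquiv 2 ℝ (Fin n → ℝ)).symm.toLinearMap
    have hf0 : ∀ i, 0 ≤ f i := fun i => Int.fract_nonneg _
    have hf1 : ∀ i, f i < 1 := fun i => Int.fract_lt_one _
    have hmem := hC.mem_of_cube_vertices_mem (a := fun i => 1 - 2 * f i)
      (fun i => abs_le.mpr ⟨by linarith [hf1 i], by linarith [hf0 i]⟩) ?_ f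
      (fun i => ⟨hf0 i, (hf1 i).le⟩) rfl
    · have hy : p + WithLp.toLp 2 f = y := by
        ext i
        simp [hp, hf, Int.floor_add_fract]
      simpa only [mem_ofPred_eq, hy] using hmem
    · intro v hv hav
      refine subset_convexHull ℝ _ ?_
      simp only [hF, Finset.coe_filter, mem_ofPred_eq, Finset.mem_image]
      refine ⟨⟨fun i => if v i = 0 then ⌊y i⌋ else ⌊y i⌋ + 1, ?_, ?_⟩, ?_⟩
      · rw [Fintype.mem_piFinset]
        intro i
        split_ifs <;> simp
      · ext i
        rcases hv i with h | h <;> simp [hp, h]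
      · rw [EuclideanSpace.norm_eq]
        refine Real.sqrt_lt_sqrt (Finset.sum_nonneg fun i _ => by positivity) ?_
        have hterm : ∀ i, ‖(p + WithLp.toLp 2 v - y) i‖ ^ 2 ≤
            1 / 4 + ((1 - 2 * f i) * v i - (1 - 2 * f i) * f i) := by
          intro i
          have e : (p + WithLp.toLp 2 v - y) i = v i - f i := by
            simp only [hp, hf, PiLp.sub_apply, PiLp.add_apply, Int.fract]
            ring
          rw [e, Real.norm_eq_abs, sq_abs]
          rcases hv i with h | h <;> rw [h] <;> nlinarith [sq_nonneg (2 * f i - 1)]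
        have hsum := Finset.sum_le_sum fun i (_ : i ∈ Finset.univ) => hterm i
        rw [Finset.sum_add_distrib, Finset.sum_sub_distrib] at hsum
        simp only [Finset.sum_const, Finset.card_univ, Fintype.card_fin, nsmul_eq_mul] at hsum
        simp only [dotProduct] at hav
        have hn' : (2 : ℝ) ≤ n := by exact_mod_cast hn
        linarith
  · have hsub : (F : Set (EuclideanSpace ℝ (Fin n))) ⊆ ball y (Real.sqrt ((n + 1) / 2)) := by
      intro v hv
      rw [mem_ball_iff_norm]
      exact (Finset.mem_filter.mp hv).2
    exact mem_ball_iff_norm.mp (convexHull_min hsub (convex_ball _ _) hz)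
end

section
/- Let n ≥ 1. The maximum of ‖y − x‖₂² over all y ∈ {0, 1/2}ⁿ and x ∈ {0, 1}ⁿ subject to the constraint Σⱼ xⱼ ≤ ⌈Σⱼ yⱼ⌉ equals (n + 3·⌊(n+1)/3⌋)/4. In particular, this maximum is strictly less than (n+1)/2. -/
open Metric Set

theorem Fin.sum_ite_val_lt {n a : ℕ} (ha : a ≤ n) (c d : ℝ) :
    ∑ j : Fin n, (if (j : ℕ) < a then c else d) = a * c + (n - a) * d := by
  obtain ⟨b, rfl⟩ := Nat.exists_eq_add_of_le ha
  rw [Fin.sum_univ_add]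
  simp

/-- For `n ≥ 1`, the maximum of `‖y − x‖₂²` over `y ∈ {0, 1/2}ⁿ` and
`x ∈ {0, 1}ⁿ` subject to `Σⱼ xⱼ ≤ ⌈Σⱼ yⱼ⌉` equals `(n + 3⌊(n+1)/3⌋)/4`, which is
strictly less than `(n+1)/2`. -/
theorem max_dist_sq {n : ℕ} (hn : 1 ≤ n) :
    IsGreatest
      {d : ℝ | ∃ y x : EuclideanSpace ℝ (Fin n),
        (∀ j, y j = 0 ∨ y j = 1 / 2) ∧ (∀ j, x j = 0 ∨ x j = 1) ∧
        (∑ j, x j) ≤ (⌈∑ j, y j⌉ : ℝ) ∧ d = ‖y - x‖ ^ 2}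
      (((n : ℝ) + 3 * (((n + 1) / 3 : ℕ) : ℝ)) / 4) ∧
    ((n : ℝ) + 3 * (((n + 1) / 3 : ℕ) : ℝ)) / 4 < ((n : ℝ) + 1) / 2 := by
  have hq : 3 * ((n + 1) / 3) ≤ n + 1 := Nat.mul_div_le _ _
  have hqn : (n + 1) / 3 ≤ n := by omega
  have hqR : 3 * (((n + 1) / 3 : ℕ) : ℝ) ≤ n + 1 := by exact_mod_cast hq
  refine ⟨⟨?_, ?_⟩, by linarith⟩
  · generalize (n + 1) / 3 = a at hqn hqR
    refine ⟨WithLp.toLp 2 fun j => if (j : ℕ) < a then 0 else 1 / 2,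
      WithLp.toLp 2 fun j => if (j : ℕ) < a then 1 else 0, ?_, ?_, ?_, ?_⟩
    · intro j
      by_cases h : (j : ℕ) < a <;> simp [h]
    · intro j
      by_cases h : (j : ℕ) < a <;> simp [h]
    · simp only [Fin.sum_ite_val_lt hqn]
      have h : (a : ℤ) ≤ ⌈(a : ℝ) * 0 + (n - a) * (1 / 2)⌉ := by
        rw [← Int.sub_one_lt_iff, Int.lt_ceil]
        push_cast
        linarith
      have h' : (a : ℝ) ≤ (⌈(a : ℝ) * 0 + (n - a) * (1 / 2)⌉ : ℝ) := by exact_mod_cast h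
      linarith
    · rw [EuclideanSpace.real_norm_sq_eq]
      have h (j : Fin n) : ((if (j : ℕ) < a then (0 : ℝ) else 1 / 2) -
          (if (j : ℕ) < a then 1 else 0)) ^ 2 = if (j : ℕ) < a then 1 else 1 / 4 := by
        split_ifs <;> norm_num
      simp only [PiLp.sub_apply, h, Fin.sum_ite_val_lt hqn]
      ring
  · rintro d ⟨y, x, hy, hx, hxy, rfl⟩
    classical
    set K := Finset.univ.filter fun j => y j = 1 / 2 with hK
    set A := Finset.univ.filter fun j => y j = 0 ∧ x j = 1 with hA
    have sumY : ∑ j, y j = K.card / 2 := by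
      have h (j : Fin n) : y j = (if y j = 1 / 2 then 1 else 0) / 2 := by
        rcases hy j with h | h <;> norm_num [h]
      rw [Finset.sum_congr rfl fun j _ => h j, ← Finset.sum_div, Finset.sum_boole]
    have sumX : (A.card : ℝ) ≤ ∑ j, x j := by
      rw [hA, ← Finset.sum_boole]
      refine Finset.sum_le_sum fun j _ => ?_
      rcases hy j with h | h <;> rcases hx j with h' | h' <;> norm_num [h, h']
    have sumD : ‖y - x‖ ^ 2 = K.card / 4 + A.card := by
      rw [EuclideanSpace.real_norm_sq_eq, hK, hA, ← Finset.sum_boole, ← Finset.sum_boole,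
        Finset.sum_div, ← Finset.sum_add_distrib]
      refine Finset.sum_congr rfl fun j _ => ?_
      rw [PiLp.sub_apply]
      rcases hy j with h | h <;> rcases hx j with h' | h' <;> norm_num [h, h']
    have hcard : K.card + A.card ≤ n := by
      have hdisj : Disjoint K A := by
        rw [Finset.disjoint_filter]
        rintro j - h ⟨h', -⟩
        norm_num [h] at h'
      rw [← Finset.card_union_of_disjoint hdisj]
      simpa using Finset.card_le_univ (K ∪ A)
    have hceil : 2 * A.card < K.card + 2 := by
      have h := Int.ceil_lt_add_one (∑ j, y j)
      have h' : 2 * (A.card : ℝ) < K.card + 2 := by linarith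
      exact_mod_cast h'
    have hA3 : A.card ≤ (n + 1) / 3 := by omega
    have hA3R : (A.card : ℝ) ≤ ((n + 1) / 3 : ℕ) := by exact_mod_cast hA3
    have hcardR : (K.card : ℝ) + A.card ≤ n := by exact_mod_cast hcard
    rw [sumD]
    linarith
end

section
/- Let n ≥ 2 and let P ⊆ ℝⁿ be a full-dimensional convex set. Then the depth of the integer hull of P satisfies depth_P(conv(P ∩ ℤⁿ)) < √((n+1)/2). -/
open Metric Set
open scoped ENNReal InnerProductSpace

/-- The set of integer points of `ℝⁿ`. -/
def intPts (n : ℕ) : Set (EuclideanSpace ℝ (Fin n)) :=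
  {x | ∀ i, ∃ m : ℤ, x i = m}


/-- Starting in `[0, 1]` and moving in a nonzero direction, one reaches an endpoint. -/
theorem exists_exit_time_unitInterval {s d : ℝ} (hs : s ∈ Icc (0 : ℝ) 1) (hd : d ≠ 0) :
    ∃ τ : ℝ, 0 ≤ τ ∧ (s + τ * d = 0 ∨ s + τ * d = 1) ∧
      ∀ u, 0 ≤ u → u ≤ τ → s + u * d ∈ Icc (0 : ℝ) 1 := by
  obtain ⟨h0, h1⟩ := hs
  rcases lt_or_gt_of_ne hd with h | h
  · have e : -s / d * d = -s := div_mul_cancel₀ _ hd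
    refine ⟨-s / d, div_nonneg_of_nonpos (by linarith) h.le, Or.inl (by linarith), ?_⟩
    intro u hu hut
    constructor <;> nlinarith
  · have e : (1 - s) / d * d = 1 - s := div_mul_cancel₀ _ hd
    refine ⟨(1 - s) / d, div_nonneg (by linarith) h.le, Or.inr (by linarith), ?_⟩
    intro u hu hut
    constructor <;> nlinarith

/-- Starting in the unit square and moving in a nonzero direction, one reaches the boundary. -/
theorem exists_exit_time_unitSquare {s t d e : ℝ} (hs : s ∈ Icc (0 : ℝ) 1)
    (ht : t ∈ Icc (0 : ℝ) 1) (hde : d ≠ 0 ∨ e ≠ 0) :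
    ∃ τ : ℝ, 0 ≤ τ ∧ s + τ * d ∈ Icc (0 : ℝ) 1 ∧ t + τ * e ∈ Icc (0 : ℝ) 1 ∧
      ((s + τ * d = 0 ∨ s + τ * d = 1) ∨ (t + τ * e = 0 ∨ t + τ * e = 1)) := by
  by_cases hd : d = 0
  · obtain ⟨τ, h0, h1, h2⟩ := exists_exit_time_unitInterval ht (hde.resolve_left (by simpa using hd))
    exact ⟨τ, h0, by simpa [hd] using hs, h2 τ h0 le_rfl, Or.inr h1⟩
  obtain ⟨τ, h0, h1, h2⟩ := exists_exit_time_unitInterval hs hd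
  by_cases he : e = 0
  · exact ⟨τ, h0, h2 τ h0 le_rfl, by simpa [he] using ht, Or.inl h1⟩
  obtain ⟨σ, k0, k1, k2⟩ := exists_exit_time_unitInterval ht he
  rcases le_total τ σ with h | h
  · exact ⟨τ, h0, h2 τ h0 le_rfl, k2 τ h0 h, Or.inl h1⟩
  · exact ⟨σ, k0, h2 σ k0 h, k2 σ k0 le_rfl, Or.inr k1⟩

/-- There is a nonzero planar direction orthogonal to a given vector and along which a given
linear form does not increase. -/
theorem exists_direction_orthogonal_nonincreasing (a b c d : ℝ) :
    ∃ p q : ℝ, (p ≠ 0 ∨ q ≠ 0) ∧ a * p + b * q = 0 ∧ c * p + d * q ≤ 0 := by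
  obtain ⟨p, q, h, h0⟩ : ∃ p q : ℝ, (p ≠ 0 ∨ q ≠ 0) ∧ a * p + b * q = 0 := by
    by_cases h : b = 0 ∧ a = 0
    · exact ⟨1, 0, by simp, by simp [h.2]⟩
    · exact ⟨b, -a, by simpa [or_iff_not_imp_left] using h, by ring⟩
  rcases le_total (c * p + d * q) 0 with hc | hc
  · exact ⟨p, q, h, h0, hc⟩
  · exact ⟨-p, -q, by simpa using h, by linarith, by linarith⟩

/-- A point of the unit cube can be rounded, without changing one linear form and without
increasing another, so that at most one coordinate is fractional. -/
theorem exists_rounding_all_but_one {ι : Type*} [Fintype ι] [Nonempty ι] (a c x : ι → ℝ)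
    (hx : ∀ i, x i ∈ Icc (0 : ℝ) 1) :
    ∃ (s : ι → ℝ) (j : ι), (∀ i, s i ∈ Icc (0 : ℝ) 1) ∧ (∀ i, i ≠ j → s i = 0 ∨ s i = 1) ∧
      ∑ i, a i * s i = ∑ i, a i * x i ∧ ∑ i, c i * s i ≤ ∑ i, c i * x i := by
  classical
  suffices H : ∀ I : Finset ι, ∃ (s : ι → ℝ) (j : ι), (∀ i, s i ∈ Icc (0 : ℝ) 1) ∧
      (∀ i ∈ I, i ≠ j → s i = 0 ∨ s i = 1) ∧
      ∑ i, a i * s i = ∑ i, a i * x i ∧ ∑ i, c i * s i ≤ ∑ i, c i * x i by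
    simpa using H Finset.univ
  intro I
  induction I using Finset.induction_on with
  | empty => exact ⟨x, Classical.arbitrary ι, hx, by simp, rfl, le_rfl⟩
  | insert k I hk ih =>
    obtain ⟨s, j, hs, hI, ha, hc⟩ := ih
    by_cases hkj : k = j
    · exact ⟨s, j, hs, fun i hi hij ↦ hI i (Finset.mem_of_mem_insert_of_ne hi (hkj ▸ hij)) hij,
        ha, hc⟩
    obtain ⟨p, q, hpq, hap, hcp⟩ := exists_direction_orthogonal_nonincreasing (a j) (a k) (c j) (c k)
    obtain ⟨τ, hτ, hj, hk', hb⟩ := exists_exit_time_unitSquare (hs j) (hs k) hpq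
    set t : ι → ℝ := fun i ↦ s i + ((if i = j then τ * p else 0) + if i = k then τ * q else 0)
      with ht
    have htj : t j = s j + τ * p := by simp [ht, Ne.symm hkj]
    have htk : t k = s k + τ * q := by simp [ht, hkj]
    have hto : ∀ i, i ≠ j → i ≠ k → t i = s i := fun i h h' ↦ by simp [ht, h, h']
    have hsum : ∀ f : ι → ℝ, ∑ i, f i * t i = ∑ i, f i * s i + τ * (f j * p + f k * q) := by
      intro f
      simp only [ht, mul_add, Finset.sum_add_distrib, mul_ite, mul_zero, Finset.sum_ite_eq',
        Finset.mem_univ, if_true]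
      ring
    have htI : ∀ i, t i ∈ Icc (0 : ℝ) 1 := by
      intro i
      by_cases h : i = j
      · rw [h, htj]; exact hj
      by_cases h' : i = k
      · rw [h', htk]; exact hk'
      rw [hto i h h']; exact hs i
    have hat : ∑ i, a i * t i = ∑ i, a i * x i := by rw [hsum, hap, ha]; ring
    have hct : ∑ i, c i * t i ≤ ∑ i, c i * x i := by
      rw [hsum]
      linarith [mul_nonpos_of_nonneg_of_nonpos hτ hcp]
    rw [← htj, ← htk] at hb
    have hrest : ∀ i ∈ insert k I, i ≠ j → i ≠ k → t i = 0 ∨ t i = 1 := fun i hi h h' ↦ by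
      rw [hto i h h']; exact hI i (Finset.mem_of_mem_insert_of_ne hi h') h
    rcases hb with hb | hb
    · refine ⟨t, k, htI, fun i hi hik ↦ ?_, hat, hct⟩
      by_cases h : i = j
      · rwa [h]
      · exact hrest i hi h hik
    · refine ⟨t, j, htI, fun i hi hij ↦ ?_, hat, hct⟩
      by_cases h : i = k
      · rwa [h]
      · exact hrest i hi hij h

/-- For a point `x` of the unit cube and a linear form `a`, some vertex `z` of the cube with
`a z ≥ a x` lies within squared distance `(n + 3) / 4` of `x`. -/
theorem exists_vertex_near_of_mem_cube {ι : Type*} [Fintype ι] [Nonempty ι] (a x : ι → ℝ)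
    (hx : ∀ i, x i ∈ Icc (0 : ℝ) 1) :
    ∃ z : ι → ℝ, (∀ i, z i = 0 ∨ z i = 1) ∧ ∑ i, a i * x i ≤ ∑ i, a i * z i ∧
      ∑ i, (z i - x i) ^ 2 ≤ ((Fintype.card ι : ℝ) + 3) / 4 := by
  classical
  obtain ⟨s, j, hs, hv, ha, hc⟩ := exists_rounding_all_but_one a (fun i ↦ 1 - 2 * x i) x hx
  obtain ⟨w, hw, haw⟩ : ∃ w : ℝ, (w = 0 ∨ w = 1) ∧ a j * s j ≤ a j * w := by
    rcases le_total 0 (a j) with h | h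
    · exact ⟨1, Or.inr rfl, mul_le_mul_of_nonneg_left (hs j).2 h⟩
    · exact ⟨0, Or.inl rfl, mul_le_mul_of_nonpos_left (hs j).1 h⟩
  set z : ι → ℝ := fun i ↦ s i + if i = j then w - s j else 0 with hz
  have hsum : ∀ f : ι → ℝ, ∑ i, f i * z i = ∑ i, f i * s i + f j * (w - s j) := by
    intro f
    simp [hz, mul_add, Finset.sum_add_distrib]
  have hz01 : ∀ i, z i = 0 ∨ z i = 1 := by
    intro i
    by_cases h : i = j
    · simpa [hz, h] using hw
    · simpa [hz, h] using hv i h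
  refine ⟨z, hz01, by rw [hsum]; linarith, ?_⟩
  have hsq : ∑ i, (z i - x i) ^ 2 = ∑ i, (1 - 2 * x i) * z i + ∑ i, x i ^ 2 := by
    rw [← Finset.sum_add_distrib]
    refine Finset.sum_congr rfl fun i _ ↦ ?_
    rcases hz01 i with h | h <;> rw [h] <;> ring
  have hcard : ∑ i, (1 - 2 * x i) * x i + ∑ i, x i ^ 2
      = (Fintype.card ι : ℝ) / 4 - ∑ i, (x i - 1 / 2) ^ 2 := by
    have : (Fintype.card ι : ℝ) / 4 = ∑ _i : ι, (1 / 4 : ℝ) := by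
      simp [div_eq_mul_inv]
    rw [this, ← Finset.sum_add_distrib, ← Finset.sum_sub_distrib]
    exact Finset.sum_congr rfl fun i _ ↦ by ring
  have hj : (x j - 1 / 2) ^ 2 ≤ ∑ i, (x i - 1 / 2) ^ 2 :=
    Finset.single_le_sum (f := fun i ↦ (x i - 1 / 2) ^ 2) (fun i _ ↦ sq_nonneg _)
      (Finset.mem_univ j)
  have hstep : (1 - 2 * x j) * (w - s j) - (x j - 1 / 2) ^ 2 ≤ 3 / 4 := by
    obtain ⟨h0, h1⟩ := hx j
    obtain ⟨k0, k1⟩ := hs j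
    rcases hw with h | h <;> subst h <;> nlinarith
  rw [hsq, hsum]
  linarith

/-- Every half-space with `x` on its boundary contains an integer point within squared distance
`(n + 3) / 4` of `x`. -/
theorem exists_intPts_near_in_halfspace {n : ℕ} (hn : 0 < n) (x : EuclideanSpace ℝ (Fin n))
    (f : EuclideanSpace ℝ (Fin n) →L[ℝ] ℝ) :
    ∃ z ∈ intPts n, z ∈ closedBall x (√(((n : ℝ) + 3) / 4)) ∧ f x ≤ f z := by
  have : Nonempty (Fin n) := ⟨⟨0, hn⟩⟩
  obtain ⟨v, hv, hav, hd⟩ := exists_vertex_near_of_mem_cube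
    (fun i ↦ f (EuclideanSpace.single i 1)) (fun i ↦ Int.fract (x i))
    fun i ↦ ⟨Int.fract_nonneg _, (Int.fract_lt_one _).le⟩
  have hf : ∀ y : EuclideanSpace ℝ (Fin n), f y = ∑ i, f (EuclideanSpace.single i 1) * y i := by
    intro y
    conv_lhs => rw [← (EuclideanSpace.basisFun (Fin n) ℝ).sum_repr y]
    simp [mul_comm]
  refine ⟨WithLp.toLp 2 fun i ↦ (⌊x i⌋ : ℝ) + v i, fun i ↦ ?_, ?_, ?_⟩
  · rcases hv i with h | h
    · exact ⟨⌊x i⌋, by simp [h]⟩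
    · exact ⟨⌊x i⌋ + 1, by simp [h]⟩
  · rw [mem_closedBall, EuclideanSpace.dist_eq]
    refine Real.sqrt_le_sqrt (le_trans (le_of_eq ?_) (by simpa using hd))
    refine Finset.sum_congr rfl fun i _ ↦ ?_
    rw [Real.dist_eq, sq_abs, Int.fract]
    ring
  · rw [hf, hf]
    have hx : ∀ i, x i = ⌊x i⌋ + Int.fract (x i) := fun i ↦ (Int.floor_add_fract _).symm
    calc ∑ i, f (EuclideanSpace.single i 1) * x i
        = ∑ i, f (EuclideanSpace.single i 1) * (⌊x i⌋ : ℝ)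
          + ∑ i, f (EuclideanSpace.single i 1) * Int.fract (x i) := by
          rw [← Finset.sum_add_distrib]
          exact Finset.sum_congr rfl fun i _ ↦ by rw [← mul_add, ← hx]
      _ ≤ ∑ i, f (EuclideanSpace.single i 1) * (⌊x i⌋ : ℝ)
          + ∑ i, f (EuclideanSpace.single i 1) * v i := by gcongr
      _ = _ := by
          rw [← Finset.sum_add_distrib]
          exact Finset.sum_congr rfl fun i _ ↦ (mul_add _ _ _).symm

theorem finite_closedBall_inter_intPts {n : ℕ} (x : EuclideanSpace ℝ (Fin n)) (r : ℝ) :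
    (closedBall x r ∩ intPts n).Finite := by
  refine ((finite_Icc (fun i ↦ ⌊x i - r⌋) (fun i ↦ ⌈x i + r⌉)).image
    fun m : Fin n → ℤ ↦ WithLp.toLp 2 fun i ↦ (m i : ℝ)).subset ?_
  rintro z ⟨hzr, hz⟩
  choose m hm using hz
  have hle : ∀ i, |(m i : ℝ) - x i| ≤ r := fun i ↦ by
    have h := (PiLp.norm_apply_le (z - x) i).trans (mem_closedBall_iff_norm.1 hzr)
    rwa [PiLp.sub_apply, hm, Real.norm_eq_abs] at h
  refine ⟨m, ⟨fun i ↦ Int.cast_le.1 ((Int.floor_le _).trans ?_),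
    fun i ↦ Int.cast_le.1 (le_trans ?_ (Int.le_ceil _))⟩, by ext i; exact (hm i).symm⟩
  · linarith [(abs_le.1 (hle i)).1]
  · linarith [(abs_le.1 (hle i)).2]

/-- Every point of `ℝⁿ` is a convex combination of integer points at squared distance at most
`(n + 3) / 4`. -/
theorem mem_convexHull_closedBall_inter_intPts {n : ℕ} (hn : 0 < n)
    (x : EuclideanSpace ℝ (Fin n)) :
    x ∈ convexHull ℝ (closedBall x (√(((n : ℝ) + 3) / 4)) ∩ intPts n) := by
  by_contra hx
  have hK : IsClosed (convexHull ℝ (closedBall x (√(((n : ℝ) + 3) / 4)) ∩ intPts n)) :=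
    (finite_closedBall_inter_intPts x _).isClosed_convexHull ℝ
  obtain ⟨f, u, hf, hu⟩ := geometric_hahn_banach_closed_point (convex_convexHull ℝ _) hK hx
  obtain ⟨z, hz, hzb, hxz⟩ := exists_intPts_near_in_halfspace hn x f
  exact absurd (hf z (subset_convexHull ℝ _ ⟨hzb, hz⟩)) (by linarith)

/-- For `n ≥ 2` and a full-dimensional convex set `P ⊆ ℝⁿ`, the depth of
the integer hull `conv(P ∩ ℤⁿ)` is less than `√((n+1)/2)`. -/
theorem depth_integerHull_lt {n : ℕ} (hn : 2 ≤ n) (P : Set (EuclideanSpace ℝ (Fin n)))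
    (hP : Convex ℝ P) (hfull : affineSpan ℝ P = ⊤) :
    setDepth P (convexHull ℝ (P ∩ intPts n))
      < ENNReal.ofReal (Real.sqrt ((n + 1) / 2)) := by
  have hn' : (2 : ℝ) ≤ n := by exact_mod_cast hn
  have hlt : √(((n : ℝ) + 3) / 4) < √(((n : ℝ) + 1) / 2) :=
    Real.sqrt_lt_sqrt (by positivity) (by linarith)
  refine lt_of_le_of_lt ?_ ((ENNReal.ofReal_lt_ofReal_iff_of_nonneg (Real.sqrt_nonneg _)).2 hlt)
  refine iSup₂_le fun x hx ↦ iSup₂_le fun r hr ↦ ENNReal.ofReal_le_ofReal ?_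
  by_contra! hlt'
  have hball : closedBall x r ⊆ P := by simpa [hfull] using hr.2
  exact hx.2 (convexHull_mono
    (inter_subset_inter_left _ ((closedBall_subset_closedBall hlt'.le).trans hball))
    (mem_convexHull_closedBall_inter_intPts (by omega) x))
end

section
/- Let n ≥ 2, d ≥ 2, and let P ⊆ ℝⁿ be a convex set with 0 ∈ P. Let L : ℝ^d → ℝⁿ be an injective linear map whose matrix has integer entries, such that the affine hull of P equals the image L(ℝ^d) and L(ℤ^d) ⊆ ℤⁿ. Let λ > 0 be such that ‖L v‖₂² ≤ λ‖v‖₂² for all v ∈ ℝ^d (e.g., λ is the largest eigenvalue of LᵀL). Then depth_P(conv(P ∩ ℤⁿ)) < √λ · √((d+1)/2). -/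
open Metric Set
open scoped ENNReal InnerProductSpace

/-- A point of `[0,1]` moved in a nonzero direction stays in `[0,1]` until it hits an endpoint. -/
lemma exists_hit_endpoint {p u : ℝ} (hp : p ∈ Icc (0 : ℝ) 1) (hu : u ≠ 0) :
    ∃ t : ℝ, 0 ≤ t ∧ (p + t * u = 0 ∨ p + t * u = 1) ∧
      ∀ s, 0 ≤ s → s ≤ t → p + s * u ∈ Icc (0 : ℝ) 1 := by
  obtain ⟨hp0, hp1⟩ := hp
  rcases lt_or_gt_of_ne hu with h | h
  · have e : p + p / (-u) * u = 0 := by field_simp; ring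
    refine ⟨p / (-u), div_nonneg hp0 (by linarith), Or.inl e, fun s hs hst => ⟨?_, ?_⟩⟩
    · nlinarith
    · nlinarith
  · have e : p + (1 - p) / u * u = 1 := by field_simp; ring
    refine ⟨(1 - p) / u, div_nonneg (by linarith) h.le, Or.inr e, fun s hs hst => ⟨?_, ?_⟩⟩
    · nlinarith
    · nlinarith

/-- A point of the unit square moved in a nonzero direction stays in the square until it hits
the boundary. -/
lemma exists_hit_square_boundary {p q u v : ℝ} (hp : p ∈ Icc (0 : ℝ) 1) (hq : q ∈ Icc (0 : ℝ) 1)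
    (huv : u ≠ 0 ∨ v ≠ 0) :
    ∃ t : ℝ, 0 ≤ t ∧ p + t * u ∈ Icc (0 : ℝ) 1 ∧ q + t * v ∈ Icc (0 : ℝ) 1 ∧
      ((p + t * u = 0 ∨ p + t * u = 1) ∨ (q + t * v = 0 ∨ q + t * v = 1)) := by
  by_cases hu : u = 0
  · obtain ⟨t, ht, he, hs⟩ := exists_hit_endpoint hq (huv.resolve_left (not_not.2 hu))
    exact ⟨t, ht, by simpa [hu] using hp, hs t ht le_rfl, Or.inr he⟩
  by_cases hv : v = 0
  · obtain ⟨t, ht, he, hs⟩ := exists_hit_endpoint hp hu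
    exact ⟨t, ht, hs t ht le_rfl, by simpa [hv] using hq, Or.inl he⟩
  obtain ⟨t, ht, he, hs⟩ := exists_hit_endpoint hp hu
  obtain ⟨t', ht', he', hs'⟩ := exists_hit_endpoint hq hv
  rcases le_total t t' with h | h
  · exact ⟨t, ht, hs t ht le_rfl, hs' t ht h, Or.inl he⟩
  · exact ⟨t', ht', hs t' ht' h, hs' t' ht' le_rfl, Or.inr he'⟩

/-- Two coordinates in `[0,1]` can be shifted so that one becomes integral, keeping one linear
functional fixed and not decreasing another one. -/
lemma exists_pipage_step {p q : ℝ} (hp : p ∈ Icc (0 : ℝ) 1) (hq : q ∈ Icc (0 : ℝ) 1)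
    (a b c e : ℝ) :
    ∃ u v : ℝ, p + u ∈ Icc (0 : ℝ) 1 ∧ q + v ∈ Icc (0 : ℝ) 1 ∧
      ((p + u = 0 ∨ p + u = 1) ∨ (q + v = 0 ∨ q + v = 1)) ∧
      c * u + e * v = 0 ∧ 0 ≤ a * u + b * v := by
  obtain ⟨u, v, huv, hc, ha⟩ :
      ∃ u v : ℝ, (u ≠ 0 ∨ v ≠ 0) ∧ c * u + e * v = 0 ∧ 0 ≤ a * u + b * v := by
    obtain ⟨u, v, huv, hc⟩ : ∃ u v : ℝ, (u ≠ 0 ∨ v ≠ 0) ∧ c * u + e * v = 0 := by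
      by_cases h : c = 0 ∧ e = 0
      · exact ⟨1, 0, by simp, by simp [h.1]⟩
      · refine ⟨e, -c, ?_, by ring⟩
        rw [neg_ne_zero]
        tauto
    rcases le_total 0 (a * u + b * v) with h | h
    · exact ⟨u, v, huv, hc, h⟩
    · exact ⟨-u, -v, by simpa using huv, by linarith, by linarith⟩
  obtain ⟨t, ht, h1, h2, h3⟩ := exists_hit_square_boundary hp hq huv
  refine ⟨t * u, t * v, h1, h2, h3, ?_, ?_⟩
  · linear_combination t * hc
  · have := mul_nonneg ht ha
    linarith

/-- Pipage rounding: all coordinates in `s` but one can be made integral, keeping one linear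
functional fixed and not decreasing another one. -/
lemma exists_pipage_rounding {ι : Type*} [Fintype ι] (a c x : ι → ℝ)
    (hx : ∀ i, x i ∈ Icc (0 : ℝ) 1) (s : Finset ι) (hs : s.Nonempty) :
    ∃ k ∈ s, ∃ z : ι → ℝ, (∀ i, z i ∈ Icc (0 : ℝ) 1) ∧
      (∀ i ∈ s, i ≠ k → z i = 0 ∨ z i = 1) ∧
      ∑ i, c i * z i = ∑ i, c i * x i ∧ ∑ i, a i * x i ≤ ∑ i, a i * z i := by
  classical
  induction hs using Finset.Nonempty.cons_induction with
  | singleton k =>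
    exact ⟨k, by simp, x, hx, by simp +contextual, rfl, le_rfl⟩
  | cons j s hj hs ih =>
    obtain ⟨k, hk, z, hz, hint, hc, ha⟩ := ih
    have hkj : k ≠ j := fun h => hj (h ▸ hk)
    obtain ⟨u, v, hu, hv, hb, hcuv, hauv⟩ := exists_pipage_step (hz k) (hz j) (a k) (a j) (c k) (c j)
    set w : ι → ℝ := z + Pi.single k u + Pi.single j v with hw
    have hsum (f : ι → ℝ) : ∑ i, f i * w i = ∑ i, f i * z i + (f k * u + f j * v) := by
      simp [hw, mul_add, Finset.sum_add_distrib, Pi.single_apply, add_assoc]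
    have hwk : w k = z k + u := by simp [hw, hkj]
    have hwj : w j = z j + v := by simp [hw, hkj.symm]
    have hwi (i : ι) (h1 : i ≠ k) (h2 : i ≠ j) : w i = z i := by simp [hw, h1, h2]
    have hwI (i : ι) : w i ∈ Icc (0 : ℝ) 1 := by
      by_cases h1 : i = k
      · rw [h1, hwk]; exact hu
      by_cases h2 : i = j
      · rw [h2, hwj]; exact hv
      rw [hwi i h1 h2]; exact hz i
    have hc' : ∑ i, c i * w i = ∑ i, c i * x i := by rw [hsum, hcuv, hc, add_zero]
    have ha' : ∑ i, a i * x i ≤ ∑ i, a i * w i := by rw [hsum]; linarith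
    rcases hb with hb | hb
    · refine ⟨j, by simp, w, hwI, fun i hi hij => ?_, hc', ha'⟩
      by_cases h1 : i = k
      · rw [h1, hwk]; exact hb
      rw [hwi i h1 hij]
      exact hint i ((Finset.mem_cons.1 hi).resolve_left hij) h1
    · refine ⟨k, by simp [hk], w, hwI, fun i hi hik => ?_, hc', ha'⟩
      by_cases h2 : i = j
      · rw [h2, hwj]; exact hb
      rw [hwi i hik h2]
      exact hint i ((Finset.mem_cons.1 hi).resolve_left h2) hik

/-- Every point of the unit cube can be rounded to a vertex without decreasing a given linear
functional, at squared distance at most `(d + 3) / 4`. -/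
lemma exists_vertex_near {d : ℕ} (hd : 0 < d) (a f : Fin d → ℝ)
    (hf : ∀ i, f i ∈ Icc (0 : ℝ) 1) :
    ∃ z : Fin d → ℝ, (∀ i, z i = 0 ∨ z i = 1) ∧ ∑ i, a i * f i ≤ ∑ i, a i * z i ∧
      ∑ i, (z i - f i) ^ 2 ≤ ((d : ℝ) + 3) / 4 := by
  classical
  obtain ⟨k, -, w, hw, hint, hc, ha⟩ := exists_pipage_rounding a (fun i => 1 - 2 * f i) f hf
    Finset.univ ⟨⟨0, hd⟩, Finset.mem_univ _⟩
  obtain ⟨e, he, hek⟩ : ∃ e : ℝ, (w k + e = 0 ∨ w k + e = 1) ∧ 0 ≤ a k * e := by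
    rcases le_total 0 (a k) with h | h
    · exact ⟨1 - w k, by simp, mul_nonneg h (by linarith [(hw k).2])⟩
    · exact ⟨-w k, by simp, mul_nonneg_of_nonpos_of_nonpos h (by linarith [(hw k).1])⟩
  set z : Fin d → ℝ := w + Pi.single k e with hzdef
  have hz (i : Fin d) : z i = 0 ∨ z i = 1 := by
    by_cases h : i = k
    · simpa [hzdef, h] using he
    · simpa [hzdef, h] using hint i (Finset.mem_univ _) h
  have hsum (g : Fin d → ℝ) : ∑ i, g i * z i = ∑ i, g i * w i + g k * e := by
    simp [hzdef, mul_add, Finset.sum_add_distrib, Pi.single_apply]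
  refine ⟨z, hz, by rw [hsum]; linarith, ?_⟩
  have hcost : ∑ i, (z i - f i) ^ 2 = ∑ i, (f i - f i ^ 2) + (1 - 2 * f k) * e := by
    calc ∑ i, (z i - f i) ^ 2 = ∑ i, ((1 - 2 * f i) * z i + f i ^ 2) := by
          refine Finset.sum_congr rfl fun i _ => ?_
          rcases hz i with h | h <;> rw [h] <;> ring
      _ = ∑ i, (1 - 2 * f i) * f i + (1 - 2 * f k) * e + ∑ i, f i ^ 2 := by
          rw [Finset.sum_add_distrib, hsum, hc]
      _ = ∑ i, ((1 - 2 * f i) * f i + f i ^ 2) + (1 - 2 * f k) * e := by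
          rw [Finset.sum_add_distrib]; ring
      _ = _ := by
          congr 1
          exact Finset.sum_congr rfl fun i _ => by ring
  have he1 : |e| ≤ 1 := by
    obtain ⟨h0, h1⟩ := hw k
    rw [abs_le]
    rcases he with h | h <;> constructor <;> linarith
  have hk : f k - f k ^ 2 + (1 - 2 * f k) * e ≤ 1 := by
    obtain ⟨h0, h1⟩ := hf k
    obtain ⟨h2, h3⟩ := abs_le.1 he1
    rcases le_total (f k) (1 / 2) with h | h <;> nlinarith
  have hrest : ∑ i ∈ Finset.univ.erase k, (f i - f i ^ 2) ≤ ((d : ℝ) - 1) / 4 := by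
    calc ∑ i ∈ Finset.univ.erase k, (f i - f i ^ 2)
        ≤ ∑ i ∈ Finset.univ.erase k, (1 / 4 : ℝ) :=
          Finset.sum_le_sum fun i _ => by nlinarith [sq_nonneg (f i - 1 / 2)]
      _ = _ := by
          rw [Finset.sum_const, Finset.card_erase_of_mem (Finset.mem_univ _), Finset.card_univ,
            Fintype.card_fin, nsmul_eq_mul, Nat.cast_sub hd]
          push_cast
          ring
  rw [hcost, ← Finset.add_sum_erase _ _ (Finset.mem_univ k)]
  linarith

/-- Every point of `ℝ^d` is a convex combination of integer points at distance at most
`√((d + 3) / 4)` from it. -/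
lemma mem_convexHull_intPts_inter_closedBall {d : ℕ} (hd : 0 < d) (y : EuclideanSpace ℝ (Fin d)) :
    y ∈ convexHull ℝ (intPts d ∩ closedBall y (Real.sqrt (((d : ℝ) + 3) / 4))) := by
  classical
  let vertex : (Fin d → Bool) → EuclideanSpace ℝ (Fin d) :=
    fun b => WithLp.toLp 2 fun i => (⌊y i⌋ : ℝ) + if b i then 1 else 0
  set T := range vertex ∩ closedBall y (Real.sqrt (((d : ℝ) + 3) / 4)) with hT
  have hTsub : T ⊆ intPts d ∩ closedBall y (Real.sqrt (((d : ℝ) + 3) / 4)) := by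
    refine inter_subset_inter_left _ ?_
    rintro _ ⟨b, rfl⟩ i
    refine ⟨⌊y i⌋ + if b i then 1 else 0, ?_⟩
    simp [vertex]
  refine convexHull_mono hTsub ?_
  by_contra hy
  have hfin : T.Finite := (finite_range vertex).subset inter_subset_left
  obtain ⟨g, u, hgy, hgT⟩ :=
    geometric_hahn_banach_point_closed (convex_convexHull ℝ T) (hfin.isCompact_convexHull ℝ).isClosed hy
  let a : Fin d → ℝ := fun i => -g (EuclideanSpace.single i 1)
  have hg (v : EuclideanSpace ℝ (Fin d)) : g v = -∑ i, a i * v i := by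
    conv_lhs => rw [← (EuclideanSpace.basisFun (Fin d) ℝ).sum_repr v]
    simp [a, mul_comm]
  obtain ⟨z, hz, haz, hdist⟩ := exists_vertex_near hd a (fun i => Int.fract (y i))
    fun i => ⟨Int.fract_nonneg _, (Int.fract_lt_one _).le⟩
  have hv (i : Fin d) : vertex (fun i => decide (z i = 1)) i = ⌊y i⌋ + z i := by
    rcases hz i with h | h <;> simp [vertex, h]
  have hmem : vertex (fun i => decide (z i = 1)) ∈ T := by
    refine ⟨mem_range_self _, ?_⟩
    rw [mem_closedBall, EuclideanSpace.dist_eq]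
    refine Real.sqrt_le_sqrt (le_of_eq_of_le (Finset.sum_congr rfl fun i _ => ?_) hdist)
    rw [hv, Real.dist_eq, sq_abs, Int.fract]
    ring
  have h1 := hgT _ (subset_convexHull ℝ T hmem)
  have h2 : ∑ i, a i * y i ≤ ∑ i, a i * vertex (fun i => decide (z i = 1)) i := by
    calc ∑ i, a i * y i = ∑ i, a i * (⌊y i⌋ : ℝ) + ∑ i, a i * Int.fract (y i) := by
          rw [← Finset.sum_add_distrib]
          refine Finset.sum_congr rfl fun i _ => ?_
          rw [← mul_add, Int.floor_add_fract]
      _ ≤ ∑ i, a i * (⌊y i⌋ : ℝ) + ∑ i, a i * z i := by gcongr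
      _ = _ := by
          rw [← Finset.sum_add_distrib]
          exact Finset.sum_congr rfl fun i _ => by rw [hv, mul_add]
  rw [hg] at h1 hgy
  linarith

/-- Let `n, d ≥ 2`, `P ⊆ ℝⁿ` convex with `0 ∈ P`, and `L : ℝ^d → ℝⁿ` an
injective linear map sending integer points to integer points, with `aff(P) = L(ℝ^d)`.
If `λ > 0` satisfies `‖Lv‖² ≤ λ‖v‖²` for all `v`, then
`depth_P(conv(P ∩ ℤⁿ)) < √λ · √((d+1)/2)`. -/
theorem depth_integerHull_lt_of_lattice_basis {n d : ℕ} (hn : 2 ≤ n) (hd : 2 ≤ d)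
    (P : Set (EuclideanSpace ℝ (Fin n))) (hP : Convex ℝ P)
    (h0 : (0 : EuclideanSpace ℝ (Fin n)) ∈ P)
    (L : EuclideanSpace ℝ (Fin d) →ₗ[ℝ] EuclideanSpace ℝ (Fin n))
    (hinj : Function.Injective L)
    (hint : ∀ v : EuclideanSpace ℝ (Fin d), (∀ i, ∃ m : ℤ, v i = m) →
      ∀ i, ∃ m : ℤ, L v i = m)
    (haff : (affineSpan ℝ P : Set (EuclideanSpace ℝ (Fin n))) = Set.range L)
    (lam : ℝ) (hlam : 0 < lam)
    (hLlam : ∀ v : EuclideanSpace ℝ (Fin d), ‖L v‖ ^ 2 ≤ lam * ‖v‖ ^ 2) :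
    setDepth P (convexHull ℝ (P ∩ intPts n))
      < ENNReal.ofReal (Real.sqrt lam * Real.sqrt ((d + 1) / 2)) := by
  have hdR : (2 : ℝ) ≤ d := by exact_mod_cast hd
  set ρ := Real.sqrt (((d : ℝ) + 3) / 4) with hρ
  have hlt : Real.sqrt lam * ρ < Real.sqrt lam * Real.sqrt ((d + 1) / 2) :=
    mul_lt_mul_of_pos_left (Real.sqrt_lt_sqrt (by positivity) (by linarith)) (Real.sqrt_pos.2 hlam)
  have hL (v : EuclideanSpace ℝ (Fin d)) : ‖L v‖ ≤ Real.sqrt lam * ‖v‖ := by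
    refine le_of_sq_le_sq ?_ (by positivity)
    rw [mul_pow, Real.sq_sqrt hlam.le]
    exact hLlam v
  refine lt_of_le_of_lt (b := ENNReal.ofReal (Real.sqrt lam * ρ)) ?_
    ((ENNReal.ofReal_lt_ofReal_iff (lt_of_le_of_lt (by positivity) hlt)).2 hlt)
  refine iSup₂_le fun x hx => iSup₂_le fun r hr => ENNReal.ofReal_le_ofReal ?_
  by_contra! hrR
  refine hx.2 ?_
  obtain ⟨y, rfl⟩ : x ∈ range L := haff ▸ subset_affineSpan ℝ P hx.1
  have hy := mem_image_of_mem L (mem_convexHull_intPts_inter_closedBall (by omega) y)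
  rw [L.image_convexHull] at hy
  refine convexHull_mono ?_ hy
  rintro _ ⟨z, ⟨hz, hzy⟩, rfl⟩
  refine ⟨hr.2 ⟨?_, haff ▸ mem_range_self z⟩, hint z hz⟩
  rw [mem_closedBall, dist_eq_norm, ← map_sub]
  rw [mem_closedBall, dist_eq_norm] at hzy
  exact (hL _).trans ((mul_le_mul_of_nonneg_left hzy (Real.sqrt_nonneg _)).trans hrR.le)
end

section
/- Let P ⊆ ℝⁿ, let π ∈ ℤⁿ with π ≠ 0, let π₀ ∈ ℤ, and let x ∈ P \ P^{(π,π₀)}. Then there exists a point x' ∉ P such that ‖x − x'‖₂ ≤ 1/‖π‖₂. -/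
open Metric Set
open scoped ENNReal InnerProductSpace

/-- The split set `P^{(π,π₀)} = conv({x ∈ P : πᵀx ≤ π₀} ∪ {x ∈ P : πᵀx ≥ π₀ + 1})`. -/
def splitSet {n : ℕ} (P : Set (EuclideanSpace ℝ (Fin n)))
    (π : EuclideanSpace ℝ (Fin n)) (π₀ : ℤ) : Set (EuclideanSpace ℝ (Fin n)) :=
  convexHull ℝ ({x | x ∈ P ∧ ⟪π, x⟫_ℝ ≤ (π₀ : ℝ)} ∪ {x | x ∈ P ∧ (π₀ : ℝ) + 1 ≤ ⟪π, x⟫_ℝ})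


/-- If `π ≠ 0` and `x ∈ P \ P^{(π,π₀)}`, then there is a point `x' ∉ P`
with `‖x − x'‖₂ ≤ 1/‖π‖₂`. -/
theorem exists_close_outside_of_mem_split_compl' {n : ℕ}
    (P : Set (EuclideanSpace ℝ (Fin n)))
    (π : EuclideanSpace ℝ (Fin n)) (hπ : ∀ i, ∃ m : ℤ, π i = m) (hπ0 : π ≠ 0) (π₀ : ℤ)
    (x : EuclideanSpace ℝ (Fin n)) (hx : x ∈ P \ splitSet P π π₀) :
    ∃ x', x' ∉ P ∧ ‖x - x'‖ ≤ 1 / ‖π‖ := by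
  obtain ⟨hxP, hxS⟩ := hx
  have hN : 0 < ‖π‖ := norm_pos_iff.mpr hπ0
  have hlo : (π₀ : ℝ) < ⟪π, x⟫_ℝ := by
    by_contra! h
    exact hxS (subset_convexHull ℝ _ (Or.inl ⟨hxP, h⟩))
  have hhi : ⟪π, x⟫_ℝ < (π₀ : ℝ) + 1 := by
    by_contra! h
    exact hxS (subset_convexHull ℝ _ (Or.inr ⟨hxP, h⟩))
  have hinner (s : ℝ) : ⟪π, x + (s / ‖π‖ ^ 2) • π⟫_ℝ = ⟪π, x⟫_ℝ + s := by
    rw [inner_add_right, inner_smul_right, real_inner_self_eq_norm_sq]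
    field_simp
  have hnorm (s : ℝ) (hs : |s| ≤ 1) : ‖x - (x + (s / ‖π‖ ^ 2) • π)‖ ≤ 1 / ‖π‖ := by
    rw [sub_add_cancel_left, norm_neg, norm_smul, Real.norm_eq_abs, abs_div,
      abs_of_pos (pow_pos hN 2)]
    calc |s| / ‖π‖ ^ 2 * ‖π‖ = |s| / ‖π‖ := by field_simp
      _ ≤ 1 / ‖π‖ := by gcongr
  set t : ℝ := ⟪π, x⟫_ℝ - π₀ with ht
  by_contra! hfar
  have hP (s : ℝ) (hs : |s| ≤ 1) : x + (s / ‖π‖ ^ 2) • π ∈ P := by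
    by_contra h
    exact (hfar _ h).not_ge (hnorm s hs)
  have hleft : x + (-t / ‖π‖ ^ 2) • π ∈ splitSet P π π₀ := by
    refine subset_convexHull ℝ _ (Or.inl ⟨hP _ ?_, ?_⟩)
    · rw [abs_le]; constructor <;> linarith
    · rw [hinner]; linarith
  have hright : x + ((1 - t) / ‖π‖ ^ 2) • π ∈ splitSet P π π₀ := by
    refine subset_convexHull ℝ _ (Or.inr ⟨hP _ ?_, ?_⟩)
    · rw [abs_le]; constructor <;> linarith
    · rw [hinner]; linarith
  have hcomb : (1 - t) • (x + (-t / ‖π‖ ^ 2) • π) + t • (x + ((1 - t) / ‖π‖ ^ 2) • π) = x := by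
    module
  exact hxS (hcomb ▸ convex_convexHull ℝ _ hleft hright (by linarith) (by linarith) (by ring))
end

section
/- Let P ⊆ ℝⁿ be a full-dimensional convex set, π ∈ ℤⁿ with π ≠ 0, and π₀ ∈ ℤ. Then depth_P(P^{(π,π₀)}) ≤ 1/‖π‖₂. -/
open Metric Set
open scoped ENNReal InnerProductSpace

/-- For a full-dimensional convex set `P ⊆ ℝⁿ` and `π ≠ 0`,
`depth_P(P^{(π,π₀)}) ≤ 1/‖π‖₂`. -/
theorem depth_splitSet_le_of_fullDim {n : ℕ} (P : Set (EuclideanSpace ℝ (Fin n)))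
    (hP : Convex ℝ P) (hfull : affineSpan ℝ P = ⊤)
    (π : EuclideanSpace ℝ (Fin n)) (hπ : ∀ i, ∃ m : ℤ, π i = m) (hπ0 : π ≠ 0) (π₀ : ℤ) :
    setDepth P (splitSet P π π₀) ≤ ENNReal.ofReal (1 / ‖π‖) := by
  refine iSup₂_le fun x hx => iSup₂_le fun r hr => ?_
  obtain ⟨hxP, hxS⟩ := hx
  obtain ⟨-, hball⟩ := hr
  apply ENNReal.ofReal_le_ofReal
  by_contra! hlt
  apply hxS
  have hpos : 0 < ‖π‖ := norm_pos_iff.mpr hπ0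
  set u : EuclideanSpace ℝ (Fin n) := (‖π‖ ^ 2)⁻¹ • π with hu
  have hnorm : ‖u‖ = 1 / ‖π‖ := by
    rw [hu, norm_smul, Real.norm_of_nonneg (by positivity)]
    field_simp
  have hinner : ⟪π, u⟫_ℝ = 1 := by
    rw [hu, real_inner_smul_right, real_inner_self_eq_norm_sq]
    field_simp
  have hmem : ∀ y, dist y x = ‖u‖ → y ∈ P := fun y hy =>
    hball ⟨by rw [mem_closedBall, hy, hnorm]; exact hlt.le, by simp [hfull]⟩
  rcases le_or_gt ⟪π, x⟫_ℝ (π₀ : ℝ) with hle | hgt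
  · exact subset_convexHull ℝ _ (Or.inl ⟨hxP, hle⟩)
  rcases le_or_gt ((π₀ : ℝ) + 1) ⟪π, x⟫_ℝ with hge | hlt'
  · exact subset_convexHull ℝ _ (Or.inr ⟨hxP, hge⟩)
  have hsub : x - u ∈ splitSet P π π₀ := subset_convexHull ℝ _
    (Or.inl ⟨hmem _ (by simp), by rw [inner_sub_right, hinner]; linarith⟩)
  have hadd : x + u ∈ splitSet P π π₀ := subset_convexHull ℝ _
    (Or.inr ⟨hmem _ (by simp), by rw [inner_add_right, hinner]; linarith⟩)
  have hmid := (convex_convexHull ℝ _) hsub hadd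
    (by norm_num : (0 : ℝ) ≤ 1 / 2) (by norm_num : (0 : ℝ) ≤ 1 / 2) (by norm_num)
  have hx : (1 / 2 : ℝ) • (x - u) + (1 / 2 : ℝ) • (x + u) = x := by module
  rwa [hx] at hmid
end

section
/- For every n ≥ 1 and every ε with 0 < ε < 1, there exist a full-dimensional closed convex set P ⊆ ℝⁿ, a vector π ∈ ℤⁿ with ‖π‖₂ = 1, an integer π₀ ∈ ℤ, and a point x ∈ P \ P^{(π,π₀)} such that every point x' ∉ P satisfies ‖x − x'‖₂ > 1/‖π‖₂ − ε. (Hence the bound ‖x − x'‖₂ ≤ 1/‖π‖₂ of the split-cut boundary theorem is tight.) -/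
open Metric Set
open scoped ENNReal InnerProductSpace

/-- For every `n ≥ 1` and `0 < ε < 1`, there are a full-dimensional closed
convex set `P ⊆ ℝⁿ`, an integral `π` with `‖π‖₂ = 1`, `π₀ ∈ ℤ`, and
`x ∈ P \ P^{(π,π₀)}` such that every `x' ∉ P` satisfies `‖x − x'‖₂ > 1/‖π‖₂ − ε`;
hence the split-cut boundary bound is tight. -/
theorem split_bound_tight {n : ℕ} (hn : 1 ≤ n) (ε : ℝ) (hε0 : 0 < ε) (hε1 : ε < 1) :
    ∃ (P : Set (EuclideanSpace ℝ (Fin n))) (π : EuclideanSpace ℝ (Fin n)) (π₀ : ℤ)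
      (x : EuclideanSpace ℝ (Fin n)),
      Convex ℝ P ∧ IsClosed P ∧ affineSpan ℝ P = ⊤ ∧
      (∀ i, ∃ m : ℤ, π i = m) ∧ ‖π‖ = 1 ∧
      x ∈ P \ splitSet P π π₀ ∧
      ∀ x', x' ∉ P → 1 / ‖π‖ - ε < ‖x - x'‖ := by
  obtain ⟨i₀⟩ : Nonempty (Fin n) := ⟨⟨0, hn⟩⟩
  set v : EuclideanSpace ℝ (Fin n) := EuclideanSpace.single i₀ 1 with hv
  have hnorm : ‖v‖ = 1 := by simp [hv]
  have hvv : ⟪v, v⟫_ℝ = 1 := by rw [real_inner_self_eq_norm_sq, hnorm, one_pow]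
  have hcont : Continuous fun x : EuclideanSpace ℝ (Fin n) => ⟪v, x⟫_ℝ := by fun_prop
  have hconv (c : ℝ) : Convex ℝ {x : EuclideanSpace ℝ (Fin n) | c ≤ ⟪v, x⟫_ℝ} :=
    convex_halfSpace_ge (innerₛₗ ℝ v).isLinear c
  have hx : ⟪v, (1 - ε / 4) • v⟫_ℝ = 1 - ε / 4 := by rw [real_inner_smul_right, hvv, mul_one]
  refine ⟨{x | ε / 4 ≤ ⟪v, x⟫_ℝ}, v, 0, (1 - ε / 4) • v, hconv _,
    isClosed_le continuous_const hcont, ?_, ?_, hnorm, ⟨?_, ?_⟩, ?_⟩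
  · have hopen : IsOpen {x : EuclideanSpace ℝ (Fin n) | ε / 4 < ⟪v, x⟫_ℝ} :=
      isOpen_lt continuous_const hcont
    have hne : {x : EuclideanSpace ℝ (Fin n) | ε / 4 < ⟪v, x⟫_ℝ}.Nonempty :=
      ⟨v, by rw [mem_ofPred_eq, hvv]; linarith⟩
    rw [← top_le_iff, ← hopen.affineSpan_eq_top hne]
    exact affineSpan_mono ℝ fun x (hx : ε / 4 < ⟪v, x⟫_ℝ) => hx.le
  · intro i
    refine ⟨if i = i₀ then 1 else 0, ?_⟩
    by_cases h : i = i₀ <;> simp [hv, h]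
  · rw [mem_ofPred_eq, hx]
    linarith
  · intro hmem
    have hsub : splitSet {x | ε / 4 ≤ ⟪v, x⟫_ℝ} v 0 ⊆ {x | 1 ≤ ⟪v, x⟫_ℝ} := by
      refine convexHull_min ?_ (hconv 1)
      rintro y (⟨h₁, h₂⟩ | ⟨-, h₂⟩)
      · rw [mem_ofPred_eq] at h₁
        rw [Int.cast_zero] at h₂
        linarith
      · simpa using h₂
    have h := hsub hmem
    rw [mem_ofPred_eq, hx] at h
    linarith
  · intro y hy
    rw [mem_ofPred_eq, not_le] at hy
    have h := real_inner_le_norm v ((1 - ε / 4) • v - y)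
    rw [inner_sub_right, hx, hnorm, one_mul] at h
    rw [hnorm, div_one]
    linarith
end

section
/- Let m, n ≥ 1, f ∈ ℝ^m, R ∈ ℝ^{m×n}, and let P := { (x, s) ∈ ℝ^m × ℝⁿ : x = f + R s, s ≥ 0 }, viewed as a subset of ℝ^{m+n} with the Euclidean norm. Let P_I := { (x, s) ∈ P : x ∈ ℤ^m } and let α ∈ ℝⁿ with α ≥ 0 componentwise and α ≠ 0 be such that αᵀs ≥ 1 holds for all (x, s) ∈ P_I. Then the depth of the cut αᵀs ≥ 1 satisfies depth_P({ (x,s) ∈ P : αᵀs ≥ 1 }) ≤ min over indices j with α_j > 0 of (1/α_j)·√( (Σᵢ R_{ij}²) + 1 ). -/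
open Metric Set
open scoped ENNReal InnerProductSpace

/-- Let `P = {(x,s) ∈ ℝ^m × ℝⁿ : x = f + Rs, s ≥ 0} ⊆ ℝ^{m+n}` and let
`α ≥ 0`, `α ≠ 0` be such that `αᵀs ≥ 1` holds for every `(x,s) ∈ P` with `x ∈ ℤ^m`.
Then the depth of the cut `αᵀs ≥ 1` is at most
`min_{j : α_j > 0} (1/α_j)·√((Σᵢ R_{ij}²) + 1)`. -/
theorem depth_intersection_cut_le {m n : ℕ} (hm : 1 ≤ m) (hn : 1 ≤ n)
    (f : Fin m → ℝ) (R : Matrix (Fin m) (Fin n) ℝ)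
    (α : Fin n → ℝ) (hα0 : ∀ j, 0 ≤ α j) (hαne : α ≠ 0)
    (P : Set (EuclideanSpace ℝ (Fin m ⊕ Fin n)))
    (hPdef : P = {z | (∀ i, z (Sum.inl i) = f i + ∑ j, R i j * z (Sum.inr j)) ∧
      ∀ j, 0 ≤ z (Sum.inr j)})
    (hvalid : ∀ z ∈ P, (∀ i, ∃ k : ℤ, z (Sum.inl i) = k) →
      1 ≤ ∑ j, α j * z (Sum.inr j)) :
    ∀ j, 0 < α j →
      setDepth P {z ∈ P | 1 ≤ ∑ j', α j' * z (Sum.inr j')}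
        ≤ ENNReal.ofReal ((1 / α j) * Real.sqrt ((∑ i, R i j ^ 2) + 1)) := by
  intro j hj
  refine iSup₂_le fun z hz => iSup₂_le fun r hr => ENNReal.ofReal_le_ofReal ?_
  obtain ⟨hzP, hzS⟩ := hz
  obtain ⟨hr0, hball⟩ := hr
  have hcut : ∑ j', α j' * z (Sum.inr j') < 1 := not_le.mp fun h => hzS ⟨hzP, h⟩
  have hzP' := hzP
  rw [hPdef] at hzP'
  obtain ⟨hzx, hzs⟩ := hzP'
  have hsj : z (Sum.inr j) ≤ 1 / α j := by
    rw [le_div_iff₀ hj, mul_comm]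
    exact (Finset.single_le_sum (f := fun j' => α j' * z (Sum.inr j'))
      (fun i _ => mul_nonneg (hα0 i) (hzs i)) (Finset.mem_univ j)).trans hcut.le
  set c : ℝ := Real.sqrt ((∑ i, R i j ^ 2) + 1) with hc
  have hcpos : 0 < c := Real.sqrt_pos.mpr (by positivity)
  let d : EuclideanSpace ℝ (Fin m ⊕ Fin n) :=
    WithLp.toLp 2 (Sum.elim (fun i => R i j) (Pi.single j 1))
  have hdnorm : ‖d‖ = c := by
    simp [d, hc, EuclideanSpace.norm_eq, Pi.single_apply, apply_ite (fun x : ℝ => x ^ 2)]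
  have hzd : z + d ∈ P := by
    rw [hPdef]
    refine ⟨fun i => ?_, fun k => ?_⟩
    · simp [d, hzx i, mul_add, Finset.sum_add_distrib, Pi.single_apply, add_assoc]
    · have h1 : (0 : ℝ) ≤ (Pi.single j 1 : Fin n → ℝ) k := by
        rw [Pi.single_apply]; split_ifs <;> norm_num
      simpa [d] using add_nonneg (hzs k) h1
  have hmem : z - (r / c) • d ∈ P := by
    refine hball ⟨?_, ?_⟩
    · rw [mem_closedBall, dist_eq_norm, sub_sub_cancel_left, norm_neg, norm_smul, hdnorm,
        Real.norm_of_nonneg (by positivity), div_mul_cancel₀ _ hcpos.ne']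
    · have h := AffineMap.lineMap_mem (-(r / c)) (subset_affineSpan ℝ P hzP)
        (subset_affineSpan ℝ P hzd)
      rwa [AffineMap.lineMap_apply, vsub_eq_sub, vadd_eq_add, add_sub_cancel_left, neg_smul,
        neg_add_eq_sub] at h
  rw [hPdef] at hmem
  have hrj : r / c ≤ z (Sum.inr j) := by simpa [d] using hmem.2 j
  exact (div_le_iff₀ hcpos).mp (hrj.trans hsj)
end

section
/- Let L ⊆ ℝⁿ be an affine subspace, let P := { x ∈ L : A x ≤ b } be nonempty with aff(P) = L, where A ∈ ℝ^{m×n} (m ≥ 1) has rows a¹, …, aᵐ and b ∈ ℝ^m. For each i, let tᶦ ∈ ℝⁿ and hᵢ ∈ ℝ satisfy: ‖tᶦ‖₂ = 1, tᶦ lies in the direction of L, and { x ∈ L : (aᶦ)ᵀ x ≤ bᵢ } = { x ∈ L : (tᶦ)ᵀ x ≤ hᵢ }. Then for every x̃ ∈ P, depth_P(x̃) = min_{1 ≤ i ≤ m} ( hᵢ − (tᶦ)ᵀ x̃ ). -/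
open Metric Set
open scoped ENNReal InnerProductSpace

/-- For unit normals `t i` in the direction of `L`, the ball of radius `r ≥ 0` around `x ∈ L`
meets `L` inside the polyhedron `{y ∈ L : ⟪t i, y⟫ ≤ h i}` iff `r` is at most every slack
`h i - ⟪t i, x⟫`. -/
theorem closedBall_inter_subset_iff_forall_le_slack {E κ : Type*} [NormedAddCommGroup E]
    [InnerProductSpace ℝ E] {L : AffineSubspace ℝ E} {t : κ → E} {h : κ → ℝ}
    (ht1 : ∀ i, ‖t i‖ = 1) (ht2 : ∀ i, t i ∈ L.direction) {x : E} (hx : x ∈ L) {r : ℝ}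
    (hr : 0 ≤ r) :
    Metric.closedBall x r ∩ (L : Set E) ⊆ {y | y ∈ L ∧ ∀ i, ⟪t i, y⟫_ℝ ≤ h i} ↔
      ∀ i, r ≤ h i - ⟪t i, x⟫_ℝ := by
  constructor
  · intro hsub i
    have hball : r • t i + x ∈ Metric.closedBall x r := by
      simp [norm_smul, ht1, abs_of_nonneg hr]
    have hmem : r • t i + x ∈ L :=
      AffineSubspace.vadd_mem_of_mem_direction (L.direction.smul_mem r (ht2 i)) hx
    have hle := (hsub ⟨hball, hmem⟩).2 i
    rw [inner_add_right, real_inner_smul_right, real_inner_self_eq_norm_sq, ht1] at hle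
    linarith
  · rintro hle y ⟨hy, hyL⟩
    refine ⟨hyL, fun i => ?_⟩
    have hcs := real_inner_le_norm (t i) (y - x)
    rw [ht1, one_mul, inner_sub_right] at hcs
    rw [mem_closedBall_iff_norm] at hy
    linarith [hle i]

/-- Let `P = {x ∈ L : Ax ≤ b}` be nonempty with `aff(P) = L` (`m ≥ 1`).
If for each `i` the unit vector `tᶦ` lies in the direction of `L` and
`{x ∈ L : (aᶦ)ᵀx ≤ bᵢ} = {x ∈ L : (tᶦ)ᵀx ≤ hᵢ}`, then for every `x̃ ∈ P`,
`depth_P(x̃) = min_i (hᵢ − (tᶦ)ᵀx̃)`. -/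
theorem ptDepth_eq_min {n m : ℕ} (hm : 1 ≤ m)
    (L : AffineSubspace ℝ (EuclideanSpace ℝ (Fin n)))
    (a : Fin m → EuclideanSpace ℝ (Fin n)) (b : Fin m → ℝ)
    (P : Set (EuclideanSpace ℝ (Fin n)))
    (hPdef : P = {x | x ∈ L ∧ ∀ i, ⟪a i, x⟫_ℝ ≤ b i})
    (hne : P.Nonempty) (haff : affineSpan ℝ P = L)
    (t : Fin m → EuclideanSpace ℝ (Fin n)) (h : Fin m → ℝ)
    (ht1 : ∀ i, ‖t i‖ = 1) (ht2 : ∀ i, t i ∈ L.direction)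
    (ht3 : ∀ i, {x | x ∈ L ∧ ⟪a i, x⟫_ℝ ≤ b i} = {x | x ∈ L ∧ ⟪t i, x⟫_ℝ ≤ h i}) :
    ∀ x ∈ P,
      ptDepth P x
        = ENNReal.ofReal
            (Finset.univ.inf' ⟨⟨0, hm⟩, Finset.mem_univ _⟩
              fun i => h i - ⟪t i, x⟫_ℝ) := by
  intro x hx
  have hP : P = {y | y ∈ L ∧ ∀ i, ⟪t i, y⟫_ℝ ≤ h i} := by
    rw [hPdef]
    ext y
    exact and_congr_right fun hy => forall_congr' fun i => by
      simpa [hy] using Set.ext_iff.mp (ht3 i) y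
  rw [hP] at hx
  have hiff : ∀ r : ℝ, 0 ≤ r →
      (Metric.closedBall x r ∩ (affineSpan ℝ P : Set (EuclideanSpace ℝ (Fin n))) ⊆ P ↔
        ∀ i, r ≤ h i - ⟪t i, x⟫_ℝ) := fun r hr => by
    rw [haff, hP]
    exact closedBall_inter_subset_iff_forall_le_slack ht1 ht2 hx.1 hr
  apply le_antisymm
  · refine iSup₂_le fun r hr => ENNReal.ofReal_le_ofReal ?_
    exact Finset.le_inf' _ _ fun i _ => (hiff r hr.1).1 hr.2 i
  · have hnonneg : 0 ≤ Finset.univ.inf' ⟨⟨0, hm⟩, Finset.mem_univ _⟩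
        fun i => h i - ⟪t i, x⟫_ℝ :=
      Finset.le_inf' _ _ fun i _ => sub_nonneg.2 (hx.2 i)
    exact le_iSup₂_of_le _ ⟨hnonneg, (hiff _ hnonneg).2 fun i =>
      Finset.inf'_le _ (Finset.mem_univ i)⟩ le_rfl
end

section
/- Let L ⊆ ℝⁿ be an affine subspace, let P := { x ∈ L : A x ≤ b } be nonempty with aff(P) = L, where A ∈ ℝ^{m×n} (m ≥ 1) has rows a¹, …, aᵐ and b ∈ ℝ^m. For each i, let tᶦ ∈ ℝⁿ and hᵢ ∈ ℝ satisfy: ‖tᶦ‖₂ = 1, tᶦ lies in the direction of L, and { x ∈ L : (aᶦ)ᵀ x ≤ bᵢ } = { x ∈ L : (tᶦ)ᵀ x ≤ hᵢ }. Then for every λ ≥ 0, the set of points of P of depth at least λ is P(λ) := { x ∈ L : (tᶦ)ᵀ x + λ ≤ hᵢ for all i }; that is, { x ∈ P : depth_P(x) ≥ λ } = P(λ). -/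
open Metric Set
open scoped ENNReal InnerProductSpace

theorem ofReal_le_ptDepth {ι : Type*} [Fintype ι] {P : Set (EuclideanSpace ℝ ι)}
    {x : EuclideanSpace ℝ ι} {r : ℝ} (hr : 0 ≤ r)
    (hP : closedBall x r ∩ (affineSpan ℝ P : Set (EuclideanSpace ℝ ι)) ⊆ P) :
    ENNReal.ofReal r ≤ ptDepth P x :=
  le_iSup₂_of_le r ⟨hr, hP⟩ le_rfl

/-- The depth of `x` is at most its slack in any valid inequality `⟪t, y⟫ ≤ h` of `P` whose
unit normal `t` is parallel to the affine span of `P`. -/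
theorem ptDepth_le_ofReal_sub_inner {ι : Type*} [Fintype ι] {P : Set (EuclideanSpace ℝ ι)}
    {x t : EuclideanSpace ℝ ι} {h : ℝ} (hx : x ∈ P) (ht : ‖t‖ = 1)
    (htP : t ∈ (affineSpan ℝ P).direction) (hP : ∀ y ∈ P, ⟪t, y⟫_ℝ ≤ h) :
    ptDepth P x ≤ ENNReal.ofReal (h - ⟪t, x⟫_ℝ) := by
  refine iSup₂_le fun r hr => ENNReal.ofReal_le_ofReal ?_
  have hmem : r • t + x ∈ P := by
    refine hr.2 ⟨?_, ?_⟩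
    · simp [mem_closedBall, dist_eq_norm, norm_smul, ht, abs_of_nonneg hr.1]
    · exact AffineSubspace.vadd_mem_of_mem_direction (Submodule.smul_mem _ r htP)
        (subset_affineSpan ℝ P hx)
  have hle := hP _ hmem
  rw [inner_add_right, real_inner_smul_right, real_inner_self_eq_norm_sq, ht] at hle
  linarith

/-- In the setting of the previous theorem, for every `λ ≥ 0` the set of
points of `P` of depth at least `λ` is `P(λ) = {x ∈ L : (tᶦ)ᵀx + λ ≤ hᵢ for all i}`. -/
theorem depth_sublevel_eq {n m : ℕ} (hm : 1 ≤ m)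
    (L : AffineSubspace ℝ (EuclideanSpace ℝ (Fin n)))
    (a : Fin m → EuclideanSpace ℝ (Fin n)) (b : Fin m → ℝ)
    (P : Set (EuclideanSpace ℝ (Fin n)))
    (hPdef : P = {x | x ∈ L ∧ ∀ i, ⟪a i, x⟫_ℝ ≤ b i})
    (hne : P.Nonempty) (haff : affineSpan ℝ P = L)
    (t : Fin m → EuclideanSpace ℝ (Fin n)) (h : Fin m → ℝ)
    (ht1 : ∀ i, ‖t i‖ = 1) (ht2 : ∀ i, t i ∈ L.direction)
    (ht3 : ∀ i, {x | x ∈ L ∧ ⟪a i, x⟫_ℝ ≤ b i} = {x | x ∈ L ∧ ⟪t i, x⟫_ℝ ≤ h i}) :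
    ∀ lam : ℝ, 0 ≤ lam →
      {x ∈ P | ENNReal.ofReal lam ≤ ptDepth P x}
        = {x | x ∈ L ∧ ∀ i, ⟪t i, x⟫_ℝ + lam ≤ h i} := by
  intro lam hlam
  have hP : ∀ x, x ∈ P ↔ x ∈ L ∧ ∀ i, ⟪t i, x⟫_ℝ ≤ h i := by
    intro x
    rw [hPdef, mem_ofPred_eq]
    refine and_congr_right fun hx => forall_congr' fun i => ?_
    simpa [hx] using Set.ext_iff.mp (ht3 i) x
  ext x
  constructor
  · rintro ⟨hx, hdepth⟩
    refine ⟨((hP x).1 hx).1, fun i => ?_⟩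
    have hle := hdepth.trans (ptDepth_le_ofReal_sub_inner hx (ht1 i)
      (by rw [haff]; exact ht2 i) fun y hy => ((hP y).1 hy).2 i)
    rw [ENNReal.ofReal_le_ofReal_iff (sub_nonneg.2 (((hP x).1 hx).2 i))] at hle
    linarith
  · rintro ⟨hxL, hx⟩
    refine ⟨(hP x).2 ⟨hxL, fun i => by linarith [hx i]⟩, ofReal_le_ptDepth hlam ?_⟩
    rintro y ⟨hyx, hyL⟩
    rw [haff] at hyL
    refine (hP y).2 ⟨hyL, fun i => ?_⟩
    have hinner : ⟪t i, y - x⟫_ℝ ≤ lam := by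
      have hcs := real_inner_le_norm (t i) (y - x)
      rw [ht1, one_mul, ← dist_eq_norm] at hcs
      exact hcs.trans hyx
    rw [inner_sub_right] at hinner
    linarith [hx i]
end
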